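/- There exists P such that for every prime p ≥ P, the sequence (s_n) is non-constant; that is, there exist indices n, m ∈ {0, ..., T-1} with s_n = 0 and s_m = 1. -/

import Mathlib

/-- The primitive roots modulo `p` in increasing order: `g_1 < g_2 < … < g_{φ(p-1)}`
(0-indexed as a sorted list). -/
noncomputable def primRootsList (p : ℕ) : List ℕ :=
  ((Finset.Ico 1 p).filter fun g : ℕ => orderOf ((g : ZMod p)) = p - 1).sort (· ≤ ·)

/-- The binary sequence `s_n ≡ g_{n+1} + g_{n+2} (mod 2)` of period `T = φ(p-1) - 1`,
extended `T`-periodically. -/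
noncomputable def seqS (p n : ℕ) : ℕ :=
  ((primRootsList p).getD (n % (Nat.totient (p - 1) - 1)) 0 +
    (primRootsList p).getD (n % (Nat.totient (p - 1) - 1) + 1) 0) % 2

open ArithmeticFunction in
/-- Sum of `|μ d|` over the divisors. -/
lemma sum_divisors_abs_moebius {n : ℕ} (hn : n ≠ 0) :
    ∑ d ∈ n.divisors, |(moebius d : ℝ)| = 2 ^ n.primeFactors.card := by
  have h (d : ℕ) : |(moebius d : ℝ)| = if Squarefree d then 1 else 0 := by
    rw [← Int.cast_abs, abs_moebius]
    split_ifs <;> simp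
  simp_rw [h]
  rw [← Finset.sum_filter, Nat.sum_divisors_filter_squarefree hn]
  simp [UniqueFactorizationMonoid.primeFactors_eq_natPrimeFactors]

open ArithmeticFunction in
lemma sum_divisors_moebius_eq_ite (n : ℕ) :
    ∑ d ∈ n.divisors, moebius d = if n = 1 then 1 else 0 := by
  rw [← coe_mul_zeta_apply, moebius_mul_coe_zeta, one_apply]

namespace MulChar

section
variable {F : Type*} [Field F] [Fintype F]

lemma norm_apply_of_ne_zero (χ : MulChar F ℂ) {a : F} (ha : a ≠ 0) : ‖χ a‖ = 1 := by
  classical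
  have h : χ a ^ (Fintype.card Fˣ) = 1 := by
    rw [← Units.val_mk0 ha, ← pow_apply_coe, MulChar.pow_card_eq_one, one_apply_coe]
  exact Complex.norm_eq_one_of_pow_eq_one h Fintype.card_ne_zero

lemma norm_jacobiSum_le (χ ψ : MulChar F ℂ) (h : ¬ (χ = 1 ∧ ψ = 1)) :
    ‖jacobiSum χ ψ‖ ≤ √(Fintype.card F : ℝ) := by
  classical
  have h1 : (1 : ℝ) ≤ √(Fintype.card F : ℝ) := by
    rw [Real.one_le_sqrt]
    exact_mod_cast Fintype.card_pos
  by_cases hχ : χ = 1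
  · subst hχ
    rw [jacobiSum_one_nontrivial (by tauto)]
    simpa using h1
  by_cases hψ : ψ = 1
  · subst hψ
    rw [jacobiSum_comm, jacobiSum_one_nontrivial hχ]
    simpa using h1
  by_cases hχψ : χ * ψ = 1
  · rw [← inv_eq_of_mul_eq_one_right hχψ, jacobiSum_nontrivial_inv hχ, norm_neg,
      norm_apply_of_ne_zero χ (by simp)]
    exact h1
  have hc : ringChar ℂ ≠ ringChar F := by
    rw [ringChar.eq_zero]
    obtain ⟨n, hp, -⟩ := FiniteField.card F (ringChar F)
    exact hp.ne_zero.symm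
  have hJ := jacobiSum_mul_jacobiSum_inv hc hχ hψ hχψ
  have hstar : jacobiSum χ⁻¹ ψ⁻¹ = (starRingEnd ℂ) (jacobiSum χ ψ) := by
    simp only [jacobiSum, map_sum, map_mul]
    simp only [starRingEnd_apply, star_apply']
  rw [hstar, Complex.mul_conj, Complex.normSq_eq_norm_sq] at hJ
  have : ‖jacobiSum χ ψ‖ ^ 2 = Fintype.card F := by exact_mod_cast hJ
  rw [← this, Real.sqrt_sq (norm_nonneg _)]

lemma sum_mul_apply_add (χ ψ : MulChar F ℂ) {k : F} (hk : k ≠ 0) :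
    ∑ x, χ x * ψ (x + k) = χ (-k) * ψ k * jacobiSum χ ψ := by
  rw [jacobiSum, Finset.mul_sum, ← Equiv.sum_comp (Equiv.mulLeft₀ (-k) (neg_ne_zero.2 hk))]
  refine Finset.sum_congr rfl fun x _ ↦ ?_
  have : -k * x + k = k * (1 - x) := by ring
  change χ (-k * x) * ψ (-k * x + k) = _
  simp only [this, map_mul]
  ring

open Classical in
/-- Correlation of two multiplicative characters. -/
lemma norm_sum_mul_apply_add_sub_le (χ ψ : MulChar F ℂ) {k : F} (hk : k ≠ 0) :
    ‖∑ x, χ x * ψ (x + k) - (if χ = 1 ∧ ψ = 1 then (Fintype.card F - 1 : ℂ) else 0)‖ ≤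
      √(Fintype.card F : ℝ) := by
  rw [sum_mul_apply_add χ ψ hk]
  have hk' : -k ≠ 0 := neg_ne_zero.2 hk
  split_ifs with h
  · rw [h.1, h.2, jacobiSum_one_one, one_apply hk'.isUnit, one_apply hk.isUnit]
    rw [show (1 * 1 * ((Fintype.card F : ℂ) - 2) - (Fintype.card F - 1)) = -1 by ring, norm_neg,
      norm_one, Real.one_le_sqrt]
    exact_mod_cast Fintype.card_pos
  · rw [sub_zero, norm_mul, norm_mul, norm_apply_of_ne_zero _ hk', norm_apply_of_ne_zero _ hk,
      one_mul, one_mul]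
    exact norm_jacobiSum_le χ ψ h

/-- A character of maximal order preserves orders of elements. -/
lemma orderOf_apply_eq [DecidableEq F] {χ : MulChar F ℂ} (hχ : orderOf χ = Fintype.card Fˣ) {x : F}
    (hx : x ≠ 0) : orderOf (χ x) = orderOf x := by
  obtain ⟨g, hg⟩ := IsCyclic.exists_generator (α := Fˣ)
  have hgo : orderOf g = Fintype.card Fˣ := by
    rw [orderOf_eq_card_of_forall_mem_zpowers hg, Nat.card_eq_fintype_card]
  have hord : orderOf (χ g) = Fintype.card Fˣ := by
    refine Nat.dvd_antisymm (orderOf_dvd_of_pow_eq_one ?_) ?_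
    · rw [← pow_apply_coe, MulChar.pow_card_eq_one, one_apply_coe]
    · rw [← hχ]
      refine orderOf_dvd_of_pow_eq_one (eq_one_iff.2 fun a ↦ ?_)
      obtain ⟨j, rfl⟩ := mem_powers_iff_mem_zpowers.2 (hg a)
      rw [pow_apply_coe]
      push_cast
      rw [map_pow, ← pow_mul, mul_comm, pow_mul, pow_orderOf_eq_one, one_pow]
  obtain ⟨j, hj⟩ := mem_powers_iff_mem_zpowers.2 (hg (Units.mk0 x hx))
  have hxj : x = (g : F) ^ j := by simpa using (congrArg Units.val hj).symm
  rcases Nat.eq_zero_or_pos j with rfl | hj0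
  · simp [hxj]
  rw [hxj, map_pow, orderOf_pow' _ hj0.ne', orderOf_pow' _ hj0.ne', hord, orderOf_units, hgo]

end

end MulChar

open ArithmeticFunction in
/-- Detecting elements of full order among roots of unity. -/
lemma sum_moebius_div_mul_sum_pow {n : ℕ} (hn : n ≠ 0) {z : ℂ} (hz : z ^ n = 1) :
    ∑ d ∈ n.divisors, ∑ i ∈ Finset.range d, (moebius d / d : ℂ) * z ^ (n / d * i) =
      if orderOf z = n then 1 else 0 := by
  obtain ⟨m, hm⟩ := orderOf_dvd_of_pow_eq_one hz
  have hm0 : m ≠ 0 := by rintro rfl; simp at hm; exact hn hm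
  have ho0 : orderOf z ≠ 0 := by intro h; rw [h] at hm; simp at hm; exact hn hm
  have key (d : ℕ) (hd : d ∈ n.divisors) :
      ∑ i ∈ Finset.range d, (moebius d / d : ℂ) * z ^ (n / d * i) =
        if d ∣ m then (moebius d : ℂ) else 0 := by
    have hdn := Nat.dvd_of_mem_divisors hd
    have hd0 : d ≠ 0 := (Nat.pos_of_mem_divisors hd).ne'
    have hiff : z ^ (n / d) = 1 ↔ d ∣ m := by
      rw [← orderOf_dvd_iff_pow_eq_one]
      obtain ⟨e, he⟩ := hdn
      rw [he, Nat.mul_div_cancel_left _ (Nat.pos_of_ne_zero hd0)]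
      rw [he] at hm
      constructor
      · rintro ⟨f, rfl⟩
        refine ⟨f, mul_left_cancel₀ ho0 ?_⟩
        rw [← hm]; ring
      · rintro ⟨f, rfl⟩
        refine ⟨f, mul_left_cancel₀ hd0 ?_⟩
        rw [hm]; ring
    simp_rw [pow_mul, ← Finset.mul_sum]
    split_ifs with h
    · rw [hiff.2 h]
      simp [hd0]
    · rw [geom_sum_eq (fun h' ↦ h (hiff.1 h')), ← pow_mul, Nat.div_mul_cancel hdn, hz]
      simp
  rw [Finset.sum_congr rfl key, ← Finset.sum_filter,
    Nat.divisors_filter_dvd_of_dvd hn (hm ▸ Dvd.intro_left _ rfl), ← Int.cast_sum,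
    sum_divisors_moebius_eq_ite]
  have : m = 1 ↔ orderOf z = n := by
    constructor
    · rintro rfl; rw [hm, mul_one]
    · intro h; exact mul_left_cancel₀ ho0 (by rw [← hm, h, mul_one])
  simp [this]

section Correlation
open ArithmeticFunction
variable {F : Type*} [Field F] [Fintype F] [DecidableEq F]

/-- The index set of the character expansion of the indicator of elements of order `n`. -/
def charIndex (n : ℕ) : Finset (Σ _ : ℕ, ℕ) := n.divisors.sigma fun d ↦ Finset.range d

/-- The density `φ(n) / n`, as a sum over divisors. -/
noncomputable def moebiusDensity (n : ℕ) : ℝ := ∑ d ∈ n.divisors, (moebius d : ℝ) / d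

/-- The indicator function of the generators of the multiplicative group of `F`. -/
noncomputable def genInd (x : F) : ℝ := if orderOf x = Fintype.card Fˣ then 1 else 0

lemma genInd_eq_sum {χ : MulChar F ℂ} (hχ : orderOf χ = Fintype.card Fˣ) (x : F) :
    (genInd x : ℂ) = ∑ a ∈ charIndex (Fintype.card Fˣ),
      (moebius a.1 / a.1 : ℂ) * (χ ^ (Fintype.card Fˣ / a.1 * a.2)) x := by
  rcases eq_or_ne x 0 with rfl | hx
  · rw [Finset.sum_eq_zero fun a _ ↦ by rw [MulChar.map_zero, mul_zero]]
    simp [genInd, orderOf_zero, Fintype.card_ne_zero.symm]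
  have hz : χ x ^ Fintype.card Fˣ = 1 := by
    rw [← Units.val_mk0 hx, ← MulChar.pow_apply_coe, MulChar.pow_card_eq_one, MulChar.one_apply_coe]
  have hp (m : ℕ) : (χ ^ m) x = χ x ^ m := by
    rw [← Units.val_mk0 hx, ← MulChar.pow_apply_coe]
  simp_rw [hp]
  rw [charIndex, Finset.sum_sigma, sum_moebius_div_mul_sum_pow Fintype.card_ne_zero hz,
    MulChar.orderOf_apply_eq hχ hx, genInd]
  split_ifs <;> simp

lemma pow_eq_one_iff_of_mem_charIndex {G : Type*} [Monoid G] {χ : G} {a : Σ _ : ℕ, ℕ}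
    (ha : a ∈ charIndex (orderOf χ)) : χ ^ (orderOf χ / a.1 * a.2) = 1 ↔ a.2 = 0 := by
  obtain ⟨d, i⟩ := a
  simp only [charIndex, Finset.mem_sigma, Nat.mem_divisors, Finset.mem_range] at ha ⊢
  obtain ⟨⟨⟨e, he⟩, h0⟩, hi⟩ := ha
  rw [← orderOf_dvd_iff_pow_eq_one, he, Nat.mul_div_cancel_left _ (by omega)]
  have he0 : e ≠ 0 := by rintro rfl; exact h0 (by rw [he, mul_zero])
  constructor
  · intro h
    rw [mul_comm d e] at h
    exact Nat.eq_zero_of_dvd_of_lt (Nat.dvd_of_mul_dvd_mul_left (Nat.pos_of_ne_zero he0) h) hi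
  · rintro rfl; simp

lemma sum_charIndex_ite (n : ℕ) (c : ℝ) :
    ∑ a ∈ charIndex n, (moebius a.1 / a.1 : ℂ) * (if a.2 = 0 then (c : ℂ) else 0) =
      ((moebiusDensity n * c : ℝ) : ℂ) := by
  rw [charIndex, Finset.sum_sigma, moebiusDensity, Finset.sum_mul]
  push_cast
  refine Finset.sum_congr rfl fun d hd ↦ ?_
  simp [Nat.pos_of_mem_divisors hd]

lemma sum_charIndex_norm {n : ℕ} (hn : n ≠ 0) :
    ∑ a ∈ charIndex n, ‖(moebius a.1 / a.1 : ℂ)‖ = 2 ^ n.primeFactors.card := by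
  rw [← sum_divisors_abs_moebius hn, charIndex, Finset.sum_sigma]
  refine Finset.sum_congr rfl fun d hd ↦ ?_
  have : (d : ℝ) ≠ 0 := by exact_mod_cast (Nat.pos_of_mem_divisors hd).ne'
  simp
  field_simp

variable (F) in
lemma exists_orderOf_eq_card_units : ∃ χ : MulChar F ℂ, orderOf χ = Fintype.card Fˣ :=
  MulChar.exists_mulChar_orderOf_eq_card_units F
    (Complex.isPrimitiveRoot_exp _ Fintype.card_ne_zero)

variable (F) in
lemma sum_genInd :
    ∑ x : F, genInd x = moebiusDensity (Fintype.card Fˣ) * Fintype.card Fˣ := by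
  obtain ⟨χ, hχ⟩ := exists_orderOf_eq_card_units F
  rw [← Complex.ofReal_inj, ← sum_charIndex_ite]
  push_cast
  simp_rw [genInd_eq_sum hχ]
  rw [Finset.sum_comm]
  refine Finset.sum_congr rfl fun a ha ↦ ?_
  rw [← Finset.mul_sum]
  congr 1
  rw [← hχ] at ha ⊢
  split_ifs with h
  · rw [(pow_eq_one_iff_of_mem_charIndex ha).2 h, MulChar.sum_one_eq_card_units, hχ]
  · exact MulChar.sum_eq_zero_of_ne_one (mt (pow_eq_one_iff_of_mem_charIndex ha).1 h)

/-- The correlations of the set of generators are close to those of a random set. -/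
lemma abs_sum_genInd_mul_genInd_sub_le {k : F} (hk : k ≠ 0) :
    |∑ x : F, genInd x * genInd (x + k) -
      moebiusDensity (Fintype.card Fˣ) ^ 2 * Fintype.card Fˣ| ≤
      (2 ^ (Fintype.card Fˣ).primeFactors.card) ^ 2 * √(Fintype.card F : ℝ) := by
  obtain ⟨χ, hχ⟩ := exists_orderOf_eq_card_units F
  set n := Fintype.card Fˣ with hn
  have hn0 : n ≠ 0 := Fintype.card_ne_zero
  have hnF : (n : ℂ) = Fintype.card F - 1 := by
    rw [hn, Fintype.card_units, Nat.cast_sub Fintype.card_pos, Nat.cast_one]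
  let c (a : Σ _ : ℕ, ℕ) : ℂ := moebius a.1 / a.1
  let ψ (a : Σ _ : ℕ, ℕ) : MulChar F ℂ := χ ^ (n / a.1 * a.2)
  have h1 : ((∑ x : F, genInd x * genInd (x + k) : ℝ) : ℂ) =
      ∑ a ∈ charIndex n, ∑ b ∈ charIndex n, c a * c b * ∑ x, ψ a x * ψ b (x + k) := by
    push_cast
    simp_rw [genInd_eq_sum hχ, Finset.sum_mul_sum]
    rw [Finset.sum_comm]
    refine Finset.sum_congr rfl fun a _ ↦ ?_
    rw [Finset.sum_comm]
    refine Finset.sum_congr rfl fun b _ ↦ ?_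
    rw [Finset.mul_sum]
    refine Finset.sum_congr rfl fun x _ ↦ ?_
    simp only [c, ψ]
    ring
  have h2 : ((moebiusDensity n ^ 2 * n : ℝ) : ℂ) =
      ∑ a ∈ charIndex n, ∑ b ∈ charIndex n,
        c a * c b * (if a.2 = 0 ∧ b.2 = 0 then (n : ℂ) else 0) := by
    have h3 := sum_charIndex_ite n (moebiusDensity n * n)
    rw [← mul_assoc, ← sq] at h3
    rw [← h3]
    refine Finset.sum_congr rfl fun a _ ↦ ?_
    have h4 := sum_charIndex_ite n n
    rw [← h4]
    split_ifs with h
    · rw [Finset.mul_sum]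
      refine Finset.sum_congr rfl fun b _ ↦ ?_
      simp [c, h, mul_assoc]
    · simp [h]
  rw [← Real.norm_eq_abs, ← Complex.norm_real, Complex.ofReal_sub, h1, h2,
    ← Finset.sum_sub_distrib]
  simp_rw [← Finset.sum_sub_distrib, ← mul_sub]
  rw [← sum_charIndex_norm hn0, sq, Finset.sum_mul_sum, Finset.sum_mul]
  refine norm_sum_le_of_le _ fun a ha ↦ ?_
  rw [Finset.sum_mul]
  refine norm_sum_le_of_le _ fun b hb ↦ ?_
  rw [norm_mul, norm_mul]
  refine mul_le_mul_of_nonneg_left ?_ (by positivity)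
  have h5 := MulChar.norm_sum_mul_apply_add_sub_le (ψ a) (ψ b) hk
  rw [← hχ] at ha hb
  have ea : ψ a = 1 ↔ a.2 = 0 := by simpa only [hχ] using pow_eq_one_iff_of_mem_charIndex ha
  have eb : ψ b = 1 ↔ b.2 = 0 := by simpa only [hχ] using pow_eq_one_iff_of_mem_charIndex hb
  simpa only [ea, eb, hnF] using h5

end Correlation

lemma exists_pow_card_primeFactors_le (K : ℕ) (hK : 0 < K) :
    ∃ C : ℕ, ∀ n : ℕ, n ≠ 0 → K ^ n.primeFactors.card ≤ C * n := by
  refine ⟨K ^ K, fun n hn ↦ ?_⟩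
  rw [← Finset.card_filter_add_card_filter_not (s := n.primeFactors) (fun q ↦ q < K), pow_add]
  refine Nat.mul_le_mul (Nat.pow_le_pow_right hK ?_) ?_
  · calc _ ≤ (Finset.range K).card := Finset.card_le_card fun q hq ↦ by
          simpa using (Finset.mem_filter.1 hq).2
      _ = K := Finset.card_range K
  · calc _ ≤ ∏ q ∈ n.primeFactors with ¬ q < K, q :=
          Finset.pow_card_le_prod _ _ _ fun q hq ↦ by simpa using (Finset.mem_filter.1 hq).2
      _ ≤ ∏ q ∈ n.primeFactors, q := Finset.prod_le_prod_of_subset_of_one_le'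
          (Finset.filter_subset _ _) fun q hq _ ↦ (Nat.prime_of_mem_primeFactors hq).one_lt.le
      _ ≤ n := Nat.le_of_dvd (Nat.pos_of_ne_zero hn) (Nat.prod_primeFactors_dvd n)

lemma totient_eq_mul_prod_real (n : ℕ) :
    (n.totient : ℝ) = n * ∏ p ∈ n.primeFactors, (1 - (p : ℝ)⁻¹) := by
  have := congrArg (Rat.cast (K := ℝ)) (Nat.totient_eq_mul_prod_factors n)
  push_cast at this
  exact this

lemma totient_le_half_of_even {n : ℕ} (hn : n ≠ 0) (h2 : 2 ∣ n) :
    (n.totient : ℝ) ≤ n / 2 := by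
  rw [totient_eq_mul_prod_real, div_eq_mul_inv]
  refine mul_le_mul_of_nonneg_left ?_ (Nat.cast_nonneg _)
  have hm : 2 ∈ n.primeFactors := Nat.mem_primeFactors.2 ⟨Nat.prime_two, h2, hn⟩
  rw [← Finset.mul_prod_erase _ _ hm]
  have : ∏ p ∈ n.primeFactors.erase 2, (1 - (p : ℝ)⁻¹) ≤ 1 := by
    refine Finset.prod_le_one (fun q hq ↦ ?_) fun q hq ↦ ?_
    · have : (1 : ℝ) ≤ q := by
        exact_mod_cast (Nat.prime_of_mem_primeFactors (Finset.mem_of_mem_erase hq)).one_lt.le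
      simpa using inv_le_one_of_one_le₀ this
    · simp
  norm_num
  linarith

lemma le_two_pow_mul_totient (n : ℕ) :
    (n : ℝ) ≤ 2 ^ n.primeFactors.card * n.totient := by
  rw [totient_eq_mul_prod_real, mul_left_comm, ← Finset.prod_const, ← Finset.prod_mul_distrib]
  refine le_mul_of_one_le_right (Nat.cast_nonneg _) ?_
  refine Finset.one_le_prod fun q hq ↦ ?_
  have : (2 : ℝ) ≤ q := by exact_mod_cast (Nat.prime_of_mem_primeFactors hq).two_le
  have := inv_anti₀ two_pos this
  linarith

lemma card_filter_orderOf_eq_card_units (F : Type*) [Field F] [Fintype F] [DecidableEq F] :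
    (Finset.univ.filter fun x : F ↦ orderOf x = Fintype.card Fˣ).card =
      (Fintype.card Fˣ).totient := by
  rw [← IsCyclic.card_orderOf_eq_totient (α := Fˣ) dvd_rfl]
  symm
  refine Finset.card_bij (fun a _ ↦ (a : F)) (fun a ha ↦ ?_) (fun a _ b _ h ↦ Units.ext h)
    fun x hx ↦ ?_
  · simpa [orderOf_units] using ha
  · have hx0 : x ≠ 0 := by
      rintro rfl
      simp [orderOf_zero, Fintype.card_ne_zero.symm] at hx
    refine ⟨Units.mk0 x hx0, ?_, rfl⟩
    simpa [← orderOf_units] using hx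

lemma moebiusDensity_mul_card_units (F : Type*) [Field F] [Fintype F] [DecidableEq F] :
    moebiusDensity (Fintype.card Fˣ) * Fintype.card Fˣ = (Fintype.card Fˣ).totient := by
  rw [← sum_genInd, ← card_filter_orderOf_eq_card_units]
  simp [genInd]

lemma genInd_mul_self {F : Type*} [Field F] [Fintype F] [DecidableEq F] (x : F) :
    genInd x * genInd x = genInd x := by
  unfold genInd
  split_ifs <;> simp

lemma abs_genInd_le_one {F : Type*} [Field F] [Fintype F] [DecidableEq F] (x : F) :
    |genInd x| ≤ 1 := by
  unfold genInd
  split_ifs <;> simp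

section Window
variable {p : ℕ} [Fact p.Prime]

/-- The alternating count of primitive roots in a window of length `H`. -/
noncomputable def altWindow (H : ℕ) (x : ZMod p) : ℝ :=
  ∑ h ∈ Finset.range H, (-1) ^ h * genInd (x + (h : ZMod p))

lemma le_sum_altWindow_sq {H : ℕ} (hH : H ≤ p) :
    H * (moebiusDensity (p - 1) * (1 - moebiusDensity (p - 1)) * (p - 1)) -
      H ^ 2 * ((2 ^ (p - 1).primeFactors.card) ^ 2 * √(p : ℝ)) ≤
    ∑ x : ZMod p, altWindow H x ^ 2 := by
  have hp : p.Prime := Fact.out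
  have hcu : Fintype.card (ZMod p)ˣ = p - 1 := ZMod.card_units p
  have hn : ((p - 1 : ℕ) : ℝ) = (p : ℝ) - 1 := by simp [Nat.cast_sub hp.one_le]
  set δ := moebiusDensity (p - 1)
  set E : ℝ := (2 ^ (p - 1).primeFactors.card) ^ 2 * √(p : ℝ) with hE
  have hE0 : 0 ≤ E := by positivity
  have hexp : ∑ x : ZMod p, altWindow H x ^ 2 =
      ∑ h ∈ Finset.range H, ∑ k ∈ Finset.range H, (-1) ^ h * (-1) ^ k *
        ∑ x : ZMod p, genInd x * genInd (x + ((k : ZMod p) - h)) := by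
    simp_rw [altWindow, sq, Finset.sum_mul_sum]
    rw [Finset.sum_comm]
    refine Finset.sum_congr rfl fun h _ ↦ ?_
    rw [Finset.sum_comm]
    refine Finset.sum_congr rfl fun k _ ↦ ?_
    rw [Finset.mul_sum, ← Equiv.sum_comp (Equiv.subRight (h : ZMod p))]
    refine Finset.sum_congr rfl fun x _ ↦ ?_
    simp only [Equiv.subRight_apply, sub_add_cancel]
    rw [show x - (h : ZMod p) + k = x + (k - h) by ring]
    ring
  have hterm : ∀ h ∈ Finset.range H, ∀ k ∈ Finset.range H,
      (-1) ^ h * (-1) ^ k * (δ ^ 2 * (p - 1)) +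
        (if h = k then δ * (1 - δ) * (p - 1) else 0) - E ≤
      (-1) ^ h * (-1) ^ k * ∑ x : ZMod p, genInd x * genInd (x + ((k : ZMod p) - h)) := by
    intro h hh k hk
    rw [Finset.mem_range] at hh hk
    split_ifs with hhk
    · subst hhk
      have h1 := sum_genInd (ZMod p)
      rw [hcu, hn] at h1
      simp only [sub_self, add_zero, genInd_mul_self, h1]
      have : ((-1 : ℝ) ^ h * (-1) ^ h) = 1 := by rw [← mul_pow]; simp
      rw [this]
      linarith
    · have hne : (k : ZMod p) - h ≠ 0 := by
        rw [sub_ne_zero]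
        intro h'
        rw [ZMod.natCast_eq_natCast_iff', Nat.mod_eq_of_lt (hk.trans_le hH),
          Nat.mod_eq_of_lt (hh.trans_le hH)] at h'
        exact hhk h'.symm
      have h2 := abs_sum_genInd_mul_genInd_sub_le hne
      rw [hcu, hn, ZMod.card, ← hE, abs_le] at h2
      rw [← pow_add]
      rcases neg_one_pow_eq_or ℝ (h + k) with h3 | h3 <;> rw [h3] <;> linarith [h2.1, h2.2]
  rw [hexp]
  refine le_trans ?_ (Finset.sum_le_sum fun h hh ↦ Finset.sum_le_sum fun k hk ↦ hterm h hh k hk)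
  simp only [Finset.sum_sub_distrib, Finset.sum_add_distrib, ← Finset.sum_mul, ← Finset.mul_sum,
    Finset.sum_ite_eq, Finset.sum_const, Finset.card_range, nsmul_eq_mul]
  have h4 : ∑ h ∈ Finset.range H, (if h ∈ Finset.range H then δ * (1 - δ) * ((p : ℝ) - 1) else 0)
      = H * (δ * (1 - δ) * (p - 1)) := by
    rw [Finset.sum_congr rfl fun h hh ↦ if_pos hh]
    simp
  rw [h4]
  have h5 : 0 ≤ (∑ h ∈ Finset.range H, (-1 : ℝ) ^ h) * (∑ h ∈ Finset.range H, (-1 : ℝ) ^ h) *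
      (δ ^ 2 * (p - 1)) := by
    have : (0 : ℝ) ≤ p - 1 := by rw [← hn]; positivity
    exact mul_nonneg (mul_self_nonneg _) (by positivity)
  nlinarith

lemma abs_altWindow_le (H : ℕ) (x : ZMod p) : |altWindow H x| ≤ H := by
  refine (Finset.abs_sum_le_sum_abs _ _).trans ?_
  refine (Finset.sum_le_sum fun h _ ↦ ?_).trans (b := ∑ h ∈ Finset.range H, (1 : ℝ)) (by simp)
  rw [abs_mul, abs_pow, abs_neg, abs_one, one_pow, one_mul]
  exact abs_genInd_le_one _

lemma sum_altWindow_sq_le {H : ℕ}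
    (h : ∀ a : ℕ, a + H ≤ p → |altWindow H (a : ZMod p)| ≤ 1) :
    ∑ x : ZMod p, altWindow H x ^ 2 ≤ p + H ^ 3 := by
  have h1 : ∑ x : ZMod p, altWindow H x ^ 2 =
      ∑ a ∈ Finset.range p, altWindow H (a : ZMod p) ^ 2 := by
    refine Finset.sum_nbij' ZMod.val (fun a ↦ (a : ZMod p)) ?_ ?_ ?_ ?_ ?_
    · intro x _; simpa using ZMod.val_lt x
    · intro a _; simp
    · intro x _; simp
    · intro a ha; exact ZMod.val_cast_of_lt (by simpa using ha)
    · intro x _; simp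
  have h2 : ∀ a ∈ Finset.range p, altWindow H (a : ZMod p) ^ 2 ≤
      1 + if p < a + H then (H : ℝ) ^ 2 else 0 := by
    intro a _
    split_ifs with hc
    · have := sq_le_sq' (abs_le.1 (abs_altWindow_le H (a : ZMod p))).1
        (abs_le.1 (abs_altWindow_le H (a : ZMod p))).2
      linarith
    · rw [add_zero, sq_le_one_iff_abs_le_one]
      exact h a (not_lt.1 hc)
  rw [h1]
  refine (Finset.sum_le_sum h2).trans ?_
  rw [Finset.sum_add_distrib, ← Finset.sum_filter]
  have h3 : ((Finset.range p).filter fun a ↦ p < a + H).card ≤ H := by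
    calc _ ≤ (Finset.Ico (p - H) p).card := Finset.card_le_card fun a ha ↦ by
          simp only [Finset.mem_filter, Finset.mem_range, Finset.mem_Ico] at ha ⊢; omega
      _ ≤ H := by rw [Nat.card_Ico]; omega
  have h4 : (((Finset.range p).filter fun a ↦ p < a + H).card : ℝ) ≤ H := by exact_mod_cast h3
  simp only [Finset.sum_const, Finset.card_range, nsmul_eq_mul, mul_one]
  nlinarith [sq_nonneg (H : ℝ)]

end Window

/-- If the elements of a set alternate in parity, then signed counts over windows are bounded. -/
lemma abs_alternating_sum_le_one (Q : ℕ → Prop) [DecidablePred Q] {N : ℕ}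
    (hQ : ∀ x y, x < y → y < N → Q x → Q y → (∀ z, x < z → z < y → ¬ Q z) → Odd (x + y))
    (a H : ℕ) (haH : a + H ≤ N) :
    |∑ h ∈ Finset.range H, (-1 : ℝ) ^ h * (if Q (a + h) then 1 else 0)| ≤ 1 := by
  suffices hs : ((∀ h < H, ¬ Q (a + h)) ∧
        ∑ h ∈ Finset.range H, (-1 : ℝ) ^ h * (if Q (a + h) then 1 else 0) = 0) ∨
      ∃ k < H, Q (a + k) ∧ (∀ h < H, k < h → ¬ Q (a + h)) ∧
        (∑ h ∈ Finset.range H, (-1 : ℝ) ^ h * (if Q (a + h) then 1 else 0) = 0 ∨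
        ∑ h ∈ Finset.range H, (-1 : ℝ) ^ h * (if Q (a + h) then 1 else 0) = (-1) ^ k) by
    rcases hs with ⟨-, h⟩ | ⟨k, -, -, -, h | h⟩ <;> rw [h] <;> simp
  induction H with
  | zero => simp
  | succ H ih =>
    rw [Finset.sum_range_succ]
    by_cases hc : Q (a + H)
    · right
      refine ⟨H, Nat.lt_succ_self H, hc, fun h h1 h2 ↦ by omega, ?_⟩
      rcases ih (by omega) with ⟨-, h⟩ | ⟨k, hk, hQk, hlast, h⟩
      · right; rw [h, if_pos hc, zero_add, mul_one]
      · have hodd : Odd (a + k + (a + H)) := by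
          refine hQ _ _ (by omega) (by omega) hQk hc fun z h1 h2 ↦ ?_
          obtain ⟨w, rfl⟩ := Nat.exists_eq_add_of_le (show a ≤ z by omega)
          exact hlast w (by omega) (by omega)
        have hsign : (-1 : ℝ) ^ k = - (-1) ^ H := by
          have h1 : Odd (k + H) := by
            rw [Nat.odd_iff] at hodd ⊢; omega
          have h2 : (-1 : ℝ) ^ k * (-1) ^ H = -1 := by rw [← pow_add, h1.neg_one_pow]
          rcases neg_one_pow_eq_or ℝ H with h3 | h3 <;> rw [h3] at h2 ⊢ <;> linarith
        rcases h with h | h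
        · right; rw [h, if_pos hc, zero_add, mul_one]
        · left; rw [h, if_pos hc, hsign, mul_one, neg_add_cancel]
    · simp only [hc, if_false, mul_zero, add_zero]
      rcases ih (by omega) with ⟨h1, h⟩ | ⟨k, hk, hQk, hlast, h⟩
      · left
        refine ⟨fun j hj ↦ ?_, h⟩
        rcases Nat.lt_succ_iff_lt_or_eq.1 hj with hj | rfl
        exacts [h1 j hj, hc]
      · right
        refine ⟨k, by omega, hQk, fun j hj hkj ↦ ?_, h⟩
        rcases Nat.lt_succ_iff_lt_or_eq.1 hj with hj | rfl
        exacts [hlast j hj hkj, hc]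

lemma mem_primRootsList {p g : ℕ} :
    g ∈ primRootsList p ↔ (1 ≤ g ∧ g < p) ∧ orderOf (g : ZMod p) = p - 1 := by
  simp [primRootsList]

lemma length_primRootsList {p : ℕ} [Fact p.Prime] :
    (primRootsList p).length = (p - 1).totient := by
  have hp : p.Prime := Fact.out
  rw [primRootsList, Finset.length_sort, ← ZMod.card_units p, ← card_filter_orderOf_eq_card_units]
  refine Finset.card_bij (fun a _ ↦ (a : ZMod p)) (fun a ha ↦ ?_) (fun a ha b hb h ↦ ?_)
    fun x hx ↦ ?_
  · simp only [Finset.mem_filter, Finset.mem_univ, true_and] at ha ⊢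
    exact ha.2
  · simp only [Finset.mem_filter, Finset.mem_Ico] at ha hb
    rwa [ZMod.natCast_eq_natCast_iff', Nat.mod_eq_of_lt ha.1.2, Nat.mod_eq_of_lt hb.1.2] at h
  · simp only [Finset.mem_filter, Finset.mem_univ, true_and] at hx
    refine ⟨x.val, ?_, by simp⟩
    have hx0 : x ≠ 0 := by
      rintro rfl
      rw [orderOf_zero] at hx
      exact Fintype.card_ne_zero hx.symm
    simp only [Finset.mem_filter, Finset.mem_Ico, ZMod.natCast_val, ZMod.cast_id', id, hx, and_true]
    exact ⟨Nat.one_le_iff_ne_zero.2 (by simpa using hx0), ZMod.val_lt x⟩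

/-- Consecutive primitive roots contribute a term to the sequence. -/
lemma exists_seqS_eq {p x y : ℕ} [Fact p.Prime] (hxy : x < y)
    (hx : x ∈ primRootsList p) (hy : y ∈ primRootsList p)
    (hcons : ∀ z, x < z → z < y → z ∉ primRootsList p) :
    ∃ n < (p - 1).totient - 1, seqS p n = (x + y) % 2 := by
  obtain ⟨i, hi, rfl⟩ := List.getElem_of_mem hx
  obtain ⟨j, hj, rfl⟩ := List.getElem_of_mem hy
  have hmono : StrictMono (primRootsList p).get := (Finset.sortedLT_sort _).strictMono_get
  have hij : i < j := hmono.lt_iff_lt (a := ⟨i, hi⟩) (b := ⟨j, hj⟩) |>.1 hxy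
  have hj' : j = i + 1 := by
    by_contra hne
    have hi1 : i + 1 < (primRootsList p).length := by omega
    refine hcons (primRootsList p)[i + 1] ?_ ?_ (List.getElem_mem hi1)
    · exact hmono (a := ⟨i, hi⟩) (b := ⟨i + 1, hi1⟩) (Nat.lt_succ_self i)
    · exact hmono (a := ⟨i + 1, hi1⟩) (b := ⟨j, hj⟩) (show i + 1 < j by omega)
  subst hj'
  have hlt : i < (p - 1).totient - 1 := by
    rw [← length_primRootsList]; omega
  refine ⟨i, hlt, ?_⟩
  rw [seqS, Nat.mod_eq_of_lt hlt, List.getD_eq_getElem _ _ hi, List.getD_eq_getElem _ _ hj]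

/-- If the sequence never vanishes, then signed counts of primitive roots in windows are bounded. -/
lemma abs_altWindow_le_one {p : ℕ} [Fact p.Prime] (hp2 : 2 < p)
    (h : ∀ n < (p - 1).totient - 1, seqS p n ≠ 0) {a H : ℕ} (haH : a + H ≤ p) :
    |altWindow H (a : ZMod p)| ≤ 1 := by
  have := abs_alternating_sum_le_one (fun g : ℕ ↦ orderOf (g : ZMod p) = p - 1) (N := p)
    (fun x y hxy hy hQx hQy hz ↦ ?_) a H haH
  · simpa only [altWindow, genInd, ZMod.card_units, Nat.cast_add] using this
  have hx0 : 1 ≤ x := by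
    rw [Nat.one_le_iff_ne_zero]
    rintro rfl
    simp [orderOf_zero] at hQx
    omega
  obtain ⟨n, hn, hs⟩ := exists_seqS_eq hxy (mem_primRootsList.2 ⟨⟨hx0, hxy.trans hy⟩, hQx⟩)
    (mem_primRootsList.2 ⟨⟨hx0.trans hxy.le, hy⟩, hQy⟩)
    fun z h1 h2 h3 ↦ hz z h1 h2 (mem_primRootsList.1 h3).2
  rw [Nat.odd_iff]
  have := h n hn
  omega

lemma exists_seqS_eq_one {p : ℕ} [Fact p.Prime]
    (h : 0 < ∑ x : ZMod p, genInd x * genInd (x + 1)) :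
    ∃ n < (p - 1).totient - 1, seqS p n = 1 := by
  have hp : p.Prime := Fact.out
  obtain ⟨x, -, hx⟩ := Finset.exists_ne_zero_of_sum_ne_zero h.ne'
  have hx1 : orderOf x = p - 1 := by
    by_contra hc; rw [← ZMod.card_units p] at hc; simp [genInd, -ZMod.card_units_eq_totient, hc] at hx
  have hx2 : orderOf (x + 1) = p - 1 := by
    by_contra hc; rw [← ZMod.card_units p] at hc; simp [genInd, -ZMod.card_units_eq_totient, hc] at hx
  have hp1 : p - 1 ≠ 0 := by have := hp.two_le; omega
  have hx0 : x ≠ 0 := by rintro rfl; rw [orderOf_zero] at hx1; exact hp1 hx1.symm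
  have hx10 : x + 1 ≠ 0 := by intro h'; rw [h', orderOf_zero] at hx2; exact hp1 hx2.symm
  have hcast : ((x.val + 1 : ℕ) : ZMod p) = x + 1 := by simp
  have hlt : x.val + 1 < p := by
    refine lt_of_le_of_ne (ZMod.val_lt x) fun h' ↦ hx10 ?_
    rw [← hcast, h', ZMod.natCast_self]
  obtain ⟨n, hn, hs⟩ := exists_seqS_eq (p := p) (Nat.lt_succ_self x.val)
    (mem_primRootsList.2 ⟨⟨Nat.one_le_iff_ne_zero.2 (by simpa using hx0), ZMod.val_lt x⟩,
      by simpa using hx1⟩)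
    (mem_primRootsList.2 ⟨⟨by omega, hlt⟩, by rw [hcast, hx2]⟩) fun z h1 h2 ↦ by omega
  exact ⟨n, hn, by omega⟩

/-- For all sufficiently large primes `p`, the sequence `(s_n)` is non-constant:
there are `n, m ∈ {0, …, T-1}` with `s_n = 0` and `s_m = 1`. -/
theorem seq_nonconstant :
    ∃ P : ℕ, ∀ p : ℕ, Nat.Prime p → P ≤ p →
      ∃ n, n < Nat.totient (p - 1) - 1 ∧ ∃ m, m < Nat.totient (p - 1) - 1 ∧
        seqS p n = 0 ∧ seqS p m = 1 := by
  obtain ⟨C, hC⟩ := exists_pow_card_primeFactors_le (2 ^ 16) (by positivity)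
  refine ⟨7000 ^ 2 * C + 3, fun p hp hPp ↦ ?_⟩
  have : Fact p.Prime := ⟨hp⟩
  have hcu : Fintype.card (ZMod p)ˣ = p - 1 := ZMod.card_units p
  have hn : ((p - 1 : ℕ) : ℝ) = (p : ℝ) - 1 := by simp [Nat.cast_sub hp.one_le]
  have hn0 : p - 1 ≠ 0 := by omega
  set L : ℝ := 2 ^ (p - 1).primeFactors.card with hL
  have hL1 : 1 ≤ L := one_le_pow₀ one_le_two
  set r := √(p : ℝ) with hr
  have hr2 : r ^ 2 = p := Real.sq_sqrt (Nat.cast_nonneg _)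
  have hp3 : (3 : ℝ) ≤ p := by exact_mod_cast (show 3 ≤ p by omega)
  have hr1 : 1 ≤ r := by rw [hr, Real.one_le_sqrt]; linarith
  have hlarge : 82 * L ^ 4 < r := by
    by_contra! hc
    have h1 : L ^ 16 ≤ C * (p - 1) := by
      have := hC (p - 1) hn0
      rw [← hn, hL, ← pow_mul, mul_comm _ 16, pow_mul]
      exact_mod_cast this
    have h2 : r ^ 4 ≤ 7000 ^ 2 * L ^ 16 := by
      calc r ^ 4 ≤ (82 * L ^ 4) ^ 4 := by gcongr
        _ = 82 ^ 4 * L ^ 16 := by ring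
        _ ≤ 7000 ^ 2 * L ^ 16 := by gcongr; norm_num
    have h3 : (7000 ^ 2 * C + 3 : ℝ) ≤ p := by exact_mod_cast hPp
    have h4 : r ^ 4 = p * p := by rw [← hr2]; ring
    have h5 : (p : ℝ) * p ≤ (7000 ^ 2 * C) * p := by
      have : (0 : ℝ) ≤ C := Nat.cast_nonneg _
      nlinarith
    have := le_of_mul_le_mul_right h5 (by linarith)
    linarith
  set δ := moebiusDensity (p - 1) with hδ
  have hδn : δ * (p - 1) = (p - 1).totient := by
    rw [← hn, hδ, ← hcu]; exact moebiusDensity_mul_card_units (ZMod p)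
  have hδL : 1 ≤ L * δ := by
    have := le_two_pow_mul_totient (p - 1)
    rw [← hδn, hn, ← hL] at this
    refine le_of_mul_le_mul_right (a := (p : ℝ) - 1) ?_ (by linarith)
    linarith
  have hδ2 : δ ≤ 1 / 2 := by
    have h2 : 2 ∣ p - 1 := (hp.even_sub_one (by omega)).two_dvd
    have := totient_le_half_of_even hn0 h2
    rw [← hδn, hn] at this
    refine le_of_mul_le_mul_right (a := (p : ℝ) - 1) ?_ (by linarith)
    linarith
  have hδ0 : 0 < δ := by
    by_contra! hc
    nlinarith
  have hone : 0 < ∑ x : ZMod p, genInd x * genInd (x + 1) := by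
    have h1 := abs_sum_genInd_mul_genInd_sub_le (one_ne_zero (α := ZMod p))
    rw [hcu, hn, ZMod.card, ← hL, ← hr, ← hδ, abs_le] at h1
    have h2 : L ^ 2 * r < δ ^ 2 * (p - 1) := by
      have h3 : L ^ 2 * (L ^ 2 * r) < L ^ 2 * (δ ^ 2 * (p - 1)) := by
        calc L ^ 2 * (L ^ 2 * r) = L ^ 4 * r := by ring
          _ < (p : ℝ) - 1 := by
            have : 1 ≤ L ^ 4 := one_le_pow₀ hL1
            nlinarith
          _ ≤ (L * δ) ^ 2 * (p - 1) :=
            le_mul_of_one_le_left (by linarith) (one_le_pow₀ hδL)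
          _ = _ := by ring
      exact lt_of_mul_lt_mul_left h3 (by positivity)
    linarith [h1.1]
  obtain ⟨m, hm, hsm⟩ := exists_seqS_eq_one hone
  by_cases hzero : ∃ n < (p - 1).totient - 1, seqS p n = 0
  · obtain ⟨n, hn, hsn⟩ := hzero
    exact ⟨n, hn, m, hm, hsn, hsm⟩
  exfalso
  push Not at hzero
  set H : ℕ := 4 * 2 ^ (p - 1).primeFactors.card with hH
  have hHL : (H : ℝ) = 4 * L := by rw [hH, hL]; push_cast; rfl
  have hLpow : L ≤ L ^ 4 := le_self_pow₀ hL1 (by norm_num)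
  have hHp : H ≤ p := by
    have : (H : ℝ) ≤ p := by rw [hHL, ← hr2]; nlinarith
    exact_mod_cast this
  have hlow := le_sum_altWindow_sq hHp
  have hup := sum_altWindow_sq_le (p := p) (H := H) fun a haH ↦
    abs_altWindow_le_one (by omega) hzero haH
  rw [← hδ, ← hL, ← hr, hHL] at hlow
  rw [hHL] at hup
  have h1 : 2 * ((p : ℝ) - 1) ≤ 4 * L * (δ * (1 - δ) * (p - 1)) := by
    have : 1 / 2 ≤ L * δ * (1 - δ) := by nlinarith
    nlinarith
  have h2 : L ^ 3 ≤ L ^ 4 * r := by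
    calc L ^ 3 ≤ L ^ 4 := pow_le_pow_right₀ hL1 (by norm_num)
      _ ≤ L ^ 4 * r := le_mul_of_one_le_right (by positivity) hr1
  have h3 : 1 ≤ L ^ 4 * r := one_le_mul_of_one_le_of_one_le (one_le_pow₀ hL1) hr1
  have h4 : 82 * L ^ 4 * r < p := by rw [← hr2]; nlinarith
  nlinarith
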